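/- There exist C > 0 and N such that for all n ≥ N: E_{ν_n}[Var_A²] ≤ C·n², where the expectation is over a random balanced die A with faces in [−√3, √3] distributed according to ν_n. -/

import Mathlib

open MeasureTheory ProbabilityTheory Set
open scoped ENNReal NNReal

noncomputable def extendDie (n : ℕ) (s : ℝ) (a : Fin (n - 1) → ℝ) : Fin n → ℝ :=
  fun i => if h : (i : ℕ) < n - 1 then a ⟨i, h⟩ else s - ∑ j, a j

noncomputable def diceMeasure (n : ℕ) (lo hi s : ℝ) : Measure (Fin n → ℝ) :=
  Measure.map (extendDie n s)
    (ProbabilityTheory.cond volume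
      {a : Fin (n - 1) → ℝ | (∀ i, a i ∈ Set.Icc lo hi) ∧ (s - ∑ i, a i) ∈ Set.Icc lo hi})

/-- `g_A(x) = |{i : a_i ≤ x}| - n·(x+√3)/(2√3)` for a die with faces in `[-√3,√3]`. -/
noncomputable def gDie (n : ℕ) (A : Fin n → ℝ) (x : ℝ) : ℝ :=
  ((Finset.univ.filter fun i => A i ≤ x).card : ℝ) -
    n * ((x + Real.sqrt 3) / (2 * Real.sqrt 3))

/-- Expectation with respect to `V` uniform on `[-√3,√3]`. -/
noncomputable def meanS (f : ℝ → ℝ) : ℝ :=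
  (2 * Real.sqrt 3)⁻¹ * ∫ x in Set.Icc (-Real.sqrt 3) (Real.sqrt 3), f x

/-- `Var_A = Var(g_A(V))`. -/
noncomputable def varDie (n : ℕ) (A : Fin n → ℝ) : ℝ :=
  meanS (fun x => gDie n A x ^ 2) - meanS (gDie n A) ^ 2


open Real in
lemma sinc_sq_le (y : ℝ) : sinc y ^ 2 ≤ (1 + y ^ 2 / 4)⁻¹ := by
  by_cases hy : y = 0
  · simp [hy]
  have hpos : 0 < 1 + y ^ 2 / 4 := by positivity
  by_cases hy2 : |y| ≤ π
  · have h1 : sinc y = cos (y / 2) * sinc (y / 2) := by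
      rw [sinc_of_ne_zero hy, sinc_of_ne_zero (by simpa using hy)]
      have : sin y = 2 * sin (y / 2) * cos (y / 2) := by rw [← sin_two_mul]; ring_nf
      rw [this]; field_simp
    have h2 := abs_le.1 hy2
    have h3 : 0 ≤ cos (y / 2) := cos_nonneg_of_mem_Icc ⟨by linarith, by linarith⟩
    have h4 := cos_le_one_div_sqrt_sq_add_one (x := y / 2) (by linarith [pi_pos]) (by linarith [pi_pos])
    have h5 : cos (y / 2) ^ 2 ≤ (1 + y ^ 2 / 4)⁻¹ := by
      calc cos (y / 2) ^ 2 ≤ (1 / √((y / 2) ^ 2 + 1)) ^ 2 := by gcongr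
        _ = _ := by
          rw [div_pow, sq_sqrt (by positivity)]
          rw [one_pow, one_div]; congr 1; ring
    have h6 : sinc (y / 2) ^ 2 ≤ 1 := by
      rw [sq_le_one_iff_abs_le_one]; exact abs_sinc_le_one _
    rw [h1, mul_pow]
    calc _ ≤ cos (y / 2) ^ 2 * 1 := by gcongr
      _ ≤ _ := by simpa using h5
  · push Not at hy2
    have h9 : 9 ≤ y ^ 2 := by
      rw [← sq_abs]
      nlinarith [pi_gt_three]
    rw [sinc_of_ne_zero hy, div_pow, div_le_iff₀ (by positivity), inv_mul_eq_div,
      le_div_iff₀ hpos]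
    nlinarith [sin_sq_le_one y]

open Real in
lemma one_sub_le_sinc (y : ℝ) : 1 - y ^ 2 / 6 ≤ sinc y := by
  wlog h : 0 < y generalizing y
  · rcases eq_or_lt_of_le (not_lt.1 h) with h0 | h0
    · simp [h0]
    · have := this (-y) (by linarith)
      rwa [sinc_neg, neg_sq] at this
  rw [sinc_of_ne_zero h.ne', le_div_iff₀ h]
  have := sin_gt_sub_cube h
  nlinarith

noncomputable def unif : Measure ℝ := ProbabilityTheory.cond volume (Icc (-√3) (√3))

lemma sqrt3_pos : 0 < √(3:ℝ) := by positivity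

lemma vol_Icc3 : (volume (Icc (-√3) (√3))) = ENNReal.ofReal (2 * √3) := by
  rw [Real.volume_Icc]; congr 1; ring

instance : IsProbabilityMeasure unif := by
  unfold unif
  apply cond_isProbabilityMeasure_of_finite
  · rw [vol_Icc3]; simp
  · rw [vol_Icc3]; exact ENNReal.ofReal_ne_top

lemma integral_unif {E : Type*} [NormedAddCommGroup E] [NormedSpace ℝ E] (f : ℝ → E) :
    ∫ x, f x ∂unif = (2 * √3)⁻¹ • ∫ x in Icc (-√3) (√3), f x := by
  unfold unif
  rw [ProbabilityTheory.cond, integral_smul_measure, vol_Icc3]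
  congr 1
  rw [ENNReal.toReal_inv, ENNReal.toReal_ofReal (by positivity)]

lemma charFun_unif (u : ℝ) : charFun unif u = (Real.sinc (√3 * u) : ℂ) := by
  rw [charFun_apply_real, integral_unif]
  by_cases hu : u = 0
  · subst hu
    have := integral_unif (fun _ : ℝ => (1:ℂ))
    simp only [Complex.ofReal_zero, zero_mul, Complex.exp_zero, mul_zero, Real.sinc_zero,
      Complex.ofReal_one]
    rw [← this]; simp
  rw [integral_Icc_eq_integral_Ioc, ← intervalIntegral.integral_of_le (by linarith [sqrt3_pos])]
  have := intervalIntegral.integral_comp_mul_left (fun x : ℝ => Complex.exp (x * Complex.I)) (a := -√3) (b := √3) hu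
  have h2 : ∀ x : ℝ, Complex.exp (u * x * Complex.I) = (fun x : ℝ => Complex.exp (x * Complex.I)) (u * x) := by
    intro x; simp
  simp_rw [h2]
  rw [this, show u * -√3 = -(√3 * u) by ring, mul_comm u, integral_exp_mul_I_eq_sinc]
  have := sqrt3_pos.ne'
  rw [Complex.real_smul, Complex.real_smul]
  push_cast
  have h3 : (√3 : ℂ) ≠ 0 := by exact_mod_cast this
  have h4 : (u : ℂ) ≠ 0 := by exact_mod_cast hu
  field_simp

lemma gauss_parseval (ρ : Measure ℝ) [IsProbabilityMeasure ρ] (v : ℝ≥0) :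
    ∫ x, Complex.exp (-(v * (x:ℂ) ^ 2 / 2)) ∂ρ = ∫ u, charFun ρ u ∂(gaussianReal 0 v) := by
  have h : ∀ x : ℝ, Complex.exp (-(v * (x:ℂ) ^ 2 / 2)) = ∫ u, Complex.exp (x * u * Complex.I) ∂(gaussianReal 0 v) := by
    intro x
    rw [← charFun_apply_real, charFun_gaussianReal]
    congr 1; push_cast; ring
  simp_rw [h]
  rw [integral_integral_swap]
  · congr 1; ext u
    rw [charFun_apply_real]
    congr 1; ext x; congr 1; ring
  · apply Integrable.of_bound (C := 1)
    · apply Continuous.aestronglyMeasurable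
      fun_prop
    · refine ae_of_all _ fun p => ?_
      simp only [Function.uncurry]
      rw [← Complex.ofReal_mul, Complex.norm_exp_ofReal_mul_I]

lemma gauss_parseval_real (ρ : Measure ℝ) [IsProbabilityMeasure ρ] (v : ℝ≥0) (hv : v ≠ 0) :
    ((∫ x, Real.exp (-(v * x ^ 2 / 2)) ∂ρ : ℝ) : ℂ)
      = ∫ u, (gaussianPDFReal 0 v u : ℂ) * charFun ρ u := by
  have := gauss_parseval ρ v
  rw [integral_gaussianReal_eq_integral_smul hv] at this
  simp only [Complex.real_smul] at this
  rw [← this, ← integral_complex_ofReal]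
  congr 1; ext x; push_cast; rfl

lemma integral_inv_quad {b : ℝ} (hb : 0 < b) :
    Integrable (fun u : ℝ => (1 + b * u ^ 2)⁻¹) ∧ ∫ u : ℝ, (1 + b * u ^ 2)⁻¹ = Real.pi / √b := by
  have h : (fun u : ℝ => (1 + b * u ^ 2)⁻¹) = fun u => (fun x : ℝ => (1 + x ^ 2)⁻¹) (√b * u) := by
    ext u; simp only [mul_pow, Real.sq_sqrt hb.le]
  have hs : 0 < √b := by positivity
  rw [h]
  refine ⟨integrable_inv_one_add_sq.comp_mul_left' hs.ne', ?_⟩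
  rw [Measure.integral_comp_mul_left (fun x : ℝ => (1 + x ^ 2)⁻¹) (√b), integral_univ_inv_one_add_sq, abs_of_pos (by positivity), smul_eq_mul]
  ring

lemma gaussianPDFReal_le_one (u : ℝ) : gaussianPDFReal 0 1 u ≤ 1 := by
  unfold gaussianPDFReal
  have h1 : (√(2 * Real.pi * (1:ℝ≥0)))⁻¹ ≤ 1 := by
    apply inv_le_one_of_one_le₀
    rw [Real.one_le_sqrt]
    push_cast
    linarith [Real.pi_gt_three]
  have h2 : Real.exp (-(u - 0) ^ 2 / (2 * (1:ℝ≥0))) ≤ 1 := by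
    rw [Real.exp_le_one_iff]
    push_cast
    nlinarith [sq_nonneg (u - 0)]
  calc _ ≤ (1:ℝ) * 1 := by gcongr
    _ = 1 := by ring

lemma conc_upper (ρ : Measure ℝ) [IsProbabilityMeasure ρ] {b : ℝ} (hb : 0 < b)
    (h : ∀ u, ‖charFun ρ u‖ ≤ (1 + b * u ^ 2)⁻¹) :
    ρ.real {x | |x| ≤ √3} ≤ Real.exp (3 / 2) * (Real.pi / √b) := by
  have hI : Integrable (fun x : ℝ => Real.exp (-((1:ℝ≥0) * x ^ 2 / 2))) ρ := by
    apply Integrable.of_bound (C := 1) (by fun_prop)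
    refine ae_of_all _ fun x => ?_
    rw [Real.norm_eq_abs, Real.abs_exp, Real.exp_le_one_iff]
    push_cast; nlinarith [sq_nonneg x]
  have hms : MeasurableSet {x : ℝ | |x| ≤ √3} := measurableSet_le (by fun_prop) (by fun_prop)
  have h1 : ρ.real {x | |x| ≤ √3} ≤ ∫ x, Real.exp (3/2) * Real.exp (-((1:ℝ≥0) * x ^ 2 / 2)) ∂ρ := by
    rw [← integral_indicator_one hms]
    apply integral_mono
    · exact (integrable_const (1:ℝ)).indicator hms
    · exact hI.const_mul _
    · intro x
      simp only [indicator, mem_ofPred_eq]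
      split_ifs with hx
      · simp only [Pi.one_apply]
        rw [← Real.exp_add, Real.one_le_exp_iff]
        have : x ^ 2 ≤ 3 := by
          rw [← sq_abs, ← Real.sq_sqrt (show (0:ℝ) ≤ 3 by norm_num)]
          gcongr
        push_cast; linarith
      · positivity
  rw [integral_const_mul] at h1
  refine h1.trans ?_
  gcongr
  have h2 := gauss_parseval_real ρ 1 one_ne_zero
  obtain ⟨hi, hv⟩ := integral_inv_quad hb
  rw [← hv]
  calc _ ≤ ‖((∫ x, Real.exp (-((1:ℝ≥0) * x ^ 2 / 2)) ∂ρ : ℝ) : ℂ)‖ := by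
        rw [Complex.norm_real]; exact le_abs_self _
    _ ≤ _ := by
        rw [h2]
        apply norm_integral_le_of_norm_le hi
        refine ae_of_all _ fun u => ?_
        rw [norm_mul, Complex.norm_real, Real.norm_of_nonneg (gaussianPDFReal_nonneg _ _ _)]
        calc _ ≤ 1 * (1 + b * u ^ 2)⁻¹ := by
              gcongr
              · exact gaussianPDFReal_le_one u
              · exact h u
          _ = _ := one_mul _

lemma pdf_compare (u : ℝ) : gaussianPDFReal 0 1 u ≤
    3 * gaussianPDFReal 0 1 u - gaussianPDFReal 0 (1/4) u := by
  have : gaussianPDFReal 0 (1/4) u ≤ 2 * gaussianPDFReal 0 1 u := by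
    unfold gaussianPDFReal
    have h1 : √(2 * Real.pi * ((1:ℝ≥0):ℝ)) = 2 * √(2 * Real.pi * ((1/4:ℝ≥0):ℝ)) := by
      rw [show (2 * Real.pi * ((1:ℝ≥0):ℝ)) = 2 ^ 2 * (2 * Real.pi * ((1/4:ℝ≥0):ℝ)) by push_cast; ring]
      rw [Real.sqrt_mul (by positivity), Real.sqrt_sq (by norm_num)]
    rw [h1, mul_inv]
    have h2 : Real.exp (-(u - 0) ^ 2 / (2 * ((1/4:ℝ≥0):ℝ))) ≤ Real.exp (-(u - 0) ^ 2 / (2 * ((1:ℝ≥0):ℝ))) := by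
      apply Real.exp_le_exp.2
      push_cast
      have e1 : -(u - 0) ^ 2 / (2 * (1/4:ℝ)) = - 2 * (u - 0) ^ 2 := by ring
      have e2 : -(u - 0) ^ 2 / (2 * (1:ℝ)) = - (1/2) * (u - 0) ^ 2 := by ring
      rw [e1, e2]
      nlinarith [sq_nonneg (u - 0)]
    calc _ ≤ (√(2 * Real.pi * ((1/4:ℝ≥0):ℝ)))⁻¹ * Real.exp (-(u - 0) ^ 2 / (2 * ((1:ℝ≥0):ℝ))) := by gcongr
      _ = _ := by ring
  linarith

lemma conc_lower (ρ : Measure ℝ) [IsProbabilityMeasure ρ] {k : ℕ} (hk : 0 < k) (hke : Even k)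
    (h : ∀ u, charFun ρ u = ((Real.sinc (√3 * u) ^ k : ℝ) : ℂ)) :
    gaussianPDFReal 0 1 1 / 3 / √k ≤ ρ.real {x | |x| ≤ √3} := by
  have hI : ∀ v : ℝ≥0, Integrable (fun x : ℝ => Real.exp (-(v * x ^ 2 / 2))) ρ := by
    intro v
    apply Integrable.of_bound (C := 1) (by fun_prop)
    refine ae_of_all _ fun x => ?_
    rw [Real.norm_eq_abs, Real.abs_exp, Real.exp_le_one_iff]
    have : 0 ≤ (v:ℝ) * x ^ 2 := by positivity
    linarith
  have hG : ∀ v : ℝ≥0, v ≠ 0 → (∫ x, Real.exp (-(v * x ^ 2 / 2)) ∂ρ)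
      = ∫ u, gaussianPDFReal 0 v u * Real.sinc (√3 * u) ^ k := by
    intro v hv
    have := gauss_parseval_real ρ v hv
    simp only [h, ← Complex.ofReal_mul] at this
    rw [integral_complex_ofReal] at this
    exact_mod_cast this
  have hGi : ∀ v : ℝ≥0, Integrable (fun u => gaussianPDFReal 0 v u * Real.sinc (√3 * u) ^ k) := by
    intro v
    apply (integrable_gaussianPDFReal 0 v).mul_bdd (c := 1)
    · exact ((Real.continuous_sinc.comp (by fun_prop)).pow k).aestronglyMeasurable
    · refine ae_of_all _ fun u => ?_
      rw [norm_pow]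
      exact pow_le_one₀ (norm_nonneg _) (Real.abs_sinc_le_one _)
  have hms : MeasurableSet {x : ℝ | |x| ≤ √3} := measurableSet_le (by fun_prop) (by fun_prop)
  have h1 : ∫ x, (3 * Real.exp (-((1:ℝ≥0) * x ^ 2 / 2)) - Real.exp (-((1/4:ℝ≥0) * x ^ 2 / 2))) ∂ρ
      ≤ 3 * ρ.real {x | |x| ≤ √3} := by
    rw [← integral_indicator_one hms, ← integral_const_mul]
    apply integral_mono
    · exact ((hI 1).const_mul 3).sub (hI (1/4))
    · exact ((integrable_const (1:ℝ)).indicator hms).const_mul 3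
    · intro x
      simp only [indicator, mem_ofPred_eq]
      split_ifs with hx
      · simp only [Pi.one_apply]
        have : Real.exp (-((1:ℝ≥0) * x ^ 2 / 2)) ≤ 1 := by
          rw [Real.exp_le_one_iff]; push_cast; nlinarith [sq_nonneg x]
        linarith [Real.exp_pos (-((1/4:ℝ≥0) * x ^ 2 / 2))]
      · push Not at hx
        have hx2 : 3 ≤ x ^ 2 := by
          rw [← sq_abs, ← Real.sq_sqrt (show (0:ℝ) ≤ 3 by norm_num)]
          gcongr
        have e3 : 3 ≤ Real.exp (9/8) := by
          rw [show (9/8:ℝ) = 1 + 1/8 by norm_num, Real.exp_add]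
          have a := Real.exp_one_gt_d9
          have b := Real.add_one_le_exp (1/8:ℝ)
          nlinarith
        have : 3 * Real.exp (-((1:ℝ≥0) * x ^ 2 / 2)) ≤ Real.exp (-((1/4:ℝ≥0) * x ^ 2 / 2)) := by
          calc _ ≤ Real.exp (9/8) * Real.exp (-((1:ℝ≥0) * x ^ 2 / 2)) := by gcongr
            _ ≤ _ := by
              rw [← Real.exp_add, Real.exp_le_exp]
              push_cast; linarith
        simp only [mul_zero]
        linarith
  rw [integral_sub ((hI 1).const_mul 3) (hI (1/4)), integral_const_mul, hG 1 one_ne_zero,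
    hG (1/4) (by norm_num), ← integral_const_mul, ← integral_sub ((hGi 1).const_mul 3) (hGi (1/4))] at h1
  have hk' : (0:ℝ) < k := by exact_mod_cast hk
  have hk1 : (1:ℝ) ≤ k := by exact_mod_cast hk
  have h2 : ∫ u in Icc (-(1/√k)) (1/√k), gaussianPDFReal 0 1 1 * (1/2) ≤
     ∫ u, (3 * (gaussianPDFReal 0 1 u * Real.sinc (√3 * u) ^ k) - gaussianPDFReal 0 (1/4) u * Real.sinc (√3 * u) ^ k) := by
    rw [← integral_indicator measurableSet_Icc]
    apply integral_mono
    · apply IntegrableOn.integrable_indicator _ measurableSet_Icc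
      exact integrableOn_const (by simp) 
    · exact ((hGi 1).const_mul 3).sub (hGi (1/4))
    · intro u
      have hs : 0 ≤ Real.sinc (√3 * u) ^ k := hke.pow_nonneg _
      have hc : gaussianPDFReal 0 1 u * Real.sinc (√3 * u) ^ k ≤ (3 * (gaussianPDFReal 0 1 u * Real.sinc (√3 * u) ^ k) - gaussianPDFReal 0 (1/4) u * Real.sinc (√3 * u) ^ k) := by
        nlinarith [mul_le_mul_of_nonneg_right (pdf_compare u) hs]
      refine le_trans ?_ hc
      simp only [indicator]
      split_ifs with hu
      · have hu2 : u ^ 2 ≤ 1 / k := by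
          have : |u| ≤ 1/√k := abs_le.2 hu
          rw [← sq_abs]
          calc |u| ^ 2 ≤ (1/√k) ^ 2 := by gcongr
            _ = 1 / (k:ℝ) := by rw [div_pow, Real.sq_sqrt hk'.le, one_pow]
        have hu3 : u ^ 2 ≤ 1 := hu2.trans (by rw [div_le_one hk']; exact hk1)
        gcongr
        · exact gaussianPDFReal_nonneg _ _ _
        · unfold gaussianPDFReal
          apply mul_le_mul_of_nonneg_left _ (by positivity)
          apply Real.exp_le_exp.2
          apply div_le_div_of_nonneg_right _ (by positivity)
          nlinarith
        · have a := one_sub_le_sinc (√3 * u)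
          rw [mul_pow, Real.sq_sqrt (by norm_num)] at a
          have b : 1 + (-(1 / (2 * k)) : ℝ) ≤ Real.sinc (√3 * u) := by
            have : 1 / (2 * (k:ℝ)) = (1/k)/2 := by field_simp
            linarith
          have hh : 1 / (2 * (k:ℝ)) ≤ 1 := by
            rw [div_le_one (by positivity)]; linarith
          calc (1/2:ℝ) = 1 + k * (-(1 / (2 * k)) : ℝ) := by field_simp; norm_num
            _ ≤ (1 + (-(1 / (2 * k)) : ℝ)) ^ k := one_add_mul_le_pow (by linarith) k
            _ ≤ _ := by gcongr; linarith
      · exact mul_nonneg (gaussianPDFReal_nonneg _ _ _) hs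
  have h3 := h2.trans h1
  rw [setIntegral_const] at h3
  have h4 : volume.real (Icc (-(1/√k)) (1/√k)) = 2 * (1 / √k) := by
    rw [Real.volume_real_Icc_of_le]
    · ring
    · have : 0 ≤ 1 / √(k:ℝ) := by positivity
      linarith
  rw [h4, smul_eq_mul] at h3
  have : gaussianPDFReal 0 1 1 / 3 / √k = (2 * (1/√k) * (gaussianPDFReal 0 1 1 * (1/2))) / 3 := by ring
  rw [this]; linarith

noncomputable def PP (k : ℕ) : Measure (Fin k → ℝ) := Measure.pi (fun _ => unif)

instance (k : ℕ) : IsProbabilityMeasure (PP k) := by unfold PP; infer_instance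

lemma PP_indep (k : ℕ) (f : ℝ → ℝ) (hf : Measurable f) :
    iIndepFun (fun (i : Fin k) (a : Fin k → ℝ) => f (a i)) (PP k) :=
  iIndepFun_pi (X := fun _ => f) (fun _ => hf.aemeasurable)

lemma PP_eval (k : ℕ) (i : Fin k) : (PP k).map (fun a => a i) = unif :=
  (measurePreserving_eval (fun _ : Fin k => unif) i).map_eq

lemma charFun_PP (k : ℕ) (J : Finset (Fin k)) (u : ℝ) :
    charFun ((PP k).map (fun a => ∑ i ∈ J, a i)) u = ((Real.sinc (√3 * u) ^ J.card : ℝ) : ℂ) := by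
  have h := (PP_indep k id measurable_id)
  have := iIndepFun.charFun_map_fun_finsetSum_eq_prod (s := J)
    (X := fun (i : Fin k) (a : Fin k → ℝ) => id (a i)) (P := PP k)
    (fun i _ => (measurable_pi_apply i).aemeasurable) (h.restrict J)
  simp only [id] at this
  rw [this]
  simp only [PP_eval, Finset.prod_const, Pi.pow_apply, charFun_unif]
  push_cast; rfl

lemma conc_upper_PP (k : ℕ) (J : Finset (Fin k)) (hJ : 2 ≤ J.card) (t : ℝ) :
    (PP k).real {a | |t + ∑ i ∈ J, a i| ≤ √3}
      ≤ Real.exp (3/2) * (Real.pi / √((J.card / 2 : ℕ) * (3/4))) := by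
  have hm : Measurable (fun a : Fin k → ℝ => ∑ i ∈ J, a i) := by fun_prop
  have hm' : Measurable (fun a : Fin k → ℝ => t + ∑ i ∈ J, a i) := by fun_prop
  set ρ := (PP k).map (fun a => t + ∑ i ∈ J, a i) with hρ
  have : IsProbabilityMeasure ρ := Measure.isProbabilityMeasure_map hm'.aemeasurable
  have hρ2 : ρ = ((PP k).map (fun a => ∑ i ∈ J, a i)).map (t + ·) := by
    rw [Measure.map_map (by fun_prop) hm]; rfl
  have hms : MeasurableSet {x : ℝ | |x| ≤ √3} := measurableSet_le (by fun_prop) (by fun_prop)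
  have e : (PP k).real {a | |t + ∑ i ∈ J, a i| ≤ √3} = ρ.real {x | |x| ≤ √3} := by
    rw [hρ, map_measureReal_apply hm' hms]; rfl
  rw [e]
  have hj : 0 < J.card / 2 := by omega
  have hj' : (0:ℝ) < (J.card / 2 : ℕ) := by exact_mod_cast hj
  apply conc_upper ρ (by positivity)
  intro u
  rw [hρ2, charFun_map_const_add, charFun_PP, norm_mul, Complex.norm_exp_ofReal_mul_I, mul_one,
    Complex.norm_real, norm_pow]
  have h1 : ‖Real.sinc (√3 * u)‖ ≤ 1 := Real.abs_sinc_le_one _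
  have h2 := sinc_sq_le (√3 * u)
  rw [mul_pow, Real.sq_sqrt (by norm_num)] at h2
  calc ‖Real.sinc (√3 * u)‖ ^ J.card ≤ ‖Real.sinc (√3 * u)‖ ^ (2 * (J.card / 2)) :=
        pow_le_pow_of_le_one (norm_nonneg _) h1 (by omega)
    _ = (Real.sinc (√3 * u) ^ 2) ^ (J.card / 2) := by rw [pow_mul, Real.norm_eq_abs, sq_abs]
    _ ≤ ((1 + 3 * u ^ 2 / 4)⁻¹) ^ (J.card / 2) := by gcongr
    _ = ((1 + 3 * u ^ 2 / 4) ^ (J.card / 2))⁻¹ := by rw [inv_pow]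
    _ ≤ _ := by
      apply inv_anti₀ (by positivity)
      have hu := sq_nonneg u
      have := one_add_mul_le_pow (a := 3 * u ^ 2 / 4) (by linarith) (J.card / 2)
      calc _ = 1 + ((J.card / 2 : ℕ) : ℝ) * (3 * u ^ 2 / 4) := by ring
        _ ≤ _ := this

lemma conc_lower_PP_even (k : ℕ) (J : Finset (Fin k)) (hJ : 0 < J.card) (hJe : Even J.card) :
    gaussianPDFReal 0 1 1 / 3 / √J.card ≤ (PP k).real {a | |∑ i ∈ J, a i| ≤ √3} := by
  have hm : Measurable (fun a : Fin k → ℝ => ∑ i ∈ J, a i) := by fun_prop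
  set ρ := (PP k).map (fun a => ∑ i ∈ J, a i) with hρ
  have : IsProbabilityMeasure ρ := Measure.isProbabilityMeasure_map hm.aemeasurable
  have hms : MeasurableSet {x : ℝ | |x| ≤ √3} := measurableSet_le (by fun_prop) (by fun_prop)
  have e : (PP k).real {a | |∑ i ∈ J, a i| ≤ √3} = ρ.real {x | |x| ≤ √3} := by
    rw [hρ, map_measureReal_apply hm hms]; rfl
  rw [e]
  exact conc_lower ρ hJ hJe (fun u => charFun_PP k J u)

lemma unif_Iic {x : ℝ} (hx : x ∈ Icc (-√3) (√3)) : unif.real (Iic x) = (x + √3) / (2 * √3) := by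
  have h := integral_unif (indicator (Iic x) (1 : ℝ → ℝ))
  rw [integral_indicator_one measurableSet_Iic] at h
  rw [h, setIntegral_indicator measurableSet_Iic]
  have : Icc (-√3) (√3) ∩ Iic x = Icc (-√3) x := by
    ext y; simp only [mem_inter_iff, mem_Icc, mem_Iic]
    constructor
    · rintro ⟨⟨a, b⟩, c⟩; exact ⟨a, c⟩
    · rintro ⟨a, c⟩; exact ⟨⟨a, c.trans hx.2⟩, c⟩
  rw [this]
  simp only [Pi.one_apply, setIntegral_const, smul_eq_mul, mul_one]
  rw [Real.volume_real_Icc_of_le hx.1]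
  rw [inv_mul_eq_div]; ring

lemma PP_indep_sum (k : ℕ) (S T : Finset (Fin k)) (hST : Disjoint S T) :
    IndepFun (fun a (i : S) => a i) (fun a (i : T) => a i) (PP k) :=
  (PP_indep k id measurable_id).indepFun_finset S T hST (fun i => by simp only [id]; fun_prop)

lemma unif_half1 : (1/2 : ℝ) ≤ unif.real (Iic 0) := by
  rw [unif_Iic ⟨by linarith [sqrt3_pos], sqrt3_pos.le⟩]
  have := sqrt3_pos
  rw [zero_add, le_div_iff₀ (by positivity)]; linarith

lemma unif_half2 : (1/2 : ℝ) ≤ unif.real (Ici 0) := by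
  have h := unif_Iic (x := 0) ⟨by linarith [sqrt3_pos], sqrt3_pos.le⟩
  have := sqrt3_pos
  have h2 : unif.real (Iic 0) = 1/2 := by rw [h]; field_simp; ring
  have h3 : unif.real (Iic 0)ᶜ = 1 - unif.real (Iic 0) := probReal_compl_eq_one_sub measurableSet_Iic
  have h4 : unif.real (Iic 0)ᶜ ≤ unif.real (Ici 0) := by
    refine measureReal_mono ?_ (measure_ne_top _ _)
    rw [compl_Iic]; exact Ioi_subset_Ici_self
  linarith

lemma step_lower (k : ℕ) :
    (1/2) * (PP (k+1)).real {a | |∑ i ∈ Finset.univ.erase (Fin.last k), a i| ≤ √3}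
      ≤ (PP (k+1)).real {a | |∑ i, a i| ≤ √3} := by
  set J := Finset.univ.erase (Fin.last k) with hJ
  have hd : Disjoint J ({Fin.last k} : Finset (Fin (k+1))) := by simp [hJ]
  have hI := PP_indep_sum (k+1) J {Fin.last k} hd
  have hI2 : IndepFun (fun a : Fin (k+1) → ℝ => ∑ i ∈ J, a i) (fun a => a (Fin.last k)) (PP (k+1)) := by
    have hψ : Measurable (fun w : ({Fin.last k} : Finset (Fin (k+1))) → ℝ =>
        w ⟨Fin.last k, Finset.mem_singleton_self _⟩) := measurable_pi_apply _
    have := hI.comp (φ := fun v : J → ℝ => ∑ i, v i)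
      (ψ := fun w : ({Fin.last k} : Finset (Fin (k+1))) → ℝ => w ⟨Fin.last k, Finset.mem_singleton_self _⟩) (by fun_prop) hψ
    convert this using 1
    · ext a; simp only [Function.comp]
      exact (Finset.sum_coe_sort J (fun i => a i)).symm
    · rfl
  have hsum : ∀ a : Fin (k+1) → ℝ, ∑ i, a i = ∑ i ∈ J, a i + a (Fin.last k) := by
    intro a; rw [hJ, Finset.sum_erase_add _ _ (Finset.mem_univ _)]
  have hae : ∀ᵐ a ∂(PP (k+1)), a (Fin.last k) ∈ Icc (-√3) (√3) := by
    have : ∀ᵐ x ∂unif, x ∈ Icc (-√3) (√3) := by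
      unfold unif; exact ae_cond_mem measurableSet_Icc
    rw [← PP_eval (k+1) (Fin.last k)] at this
    exact ae_of_ae_map (measurable_pi_apply _).aemeasurable this
  have key : ∀ (A B : Set ℝ), MeasurableSet A → MeasurableSet B →
      (PP (k+1)).real {a | ∑ i ∈ J, a i ∈ A ∧ a (Fin.last k) ∈ B}
       = (PP (k+1)).real {a | ∑ i ∈ J, a i ∈ A} * unif.real B := by
    intro A B hA hB
    have := hI2.measure_inter_preimage_eq_mul A B hA hB
    have e2 : unif.real B = (PP (k+1)).real ((fun a => a (Fin.last k)) ⁻¹' B) := by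
      rw [← PP_eval (k+1) (Fin.last k), map_measureReal_apply (by fun_prop) hB]
    rw [e2, measureReal_def, measureReal_def, measureReal_def, ← ENNReal.toReal_mul]
    congr 1
  have k1 := key (Icc 0 (√3)) (Iic 0) measurableSet_Icc measurableSet_Iic
  have k2 := key (Ico (-√3) 0) (Ici 0) measurableSet_Ico measurableSet_Ici
  have hm : Measurable (fun a : Fin (k+1) → ℝ => ∑ i ∈ J, a i) := by fun_prop
  have hm2 : Measurable (fun a : Fin (k+1) → ℝ => a (Fin.last k)) := by fun_prop
  have u1 : (PP (k+1)).real {a | |∑ i ∈ J, a i| ≤ √3} ≤ (PP (k+1)).real {a | ∑ i ∈ J, a i ∈ Icc 0 (√3)}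
     + (PP (k+1)).real {a | ∑ i ∈ J, a i ∈ Ico (-√3) 0} := by
    refine le_trans (measureReal_mono ?_) (measureReal_union_le _ _)
    intro a ha
    have ha := abs_le.1 (show |∑ i ∈ J, a i| ≤ √3 from ha)
    by_cases h0 : 0 ≤ ∑ i ∈ J, a i
    · left; exact ⟨h0, ha.2⟩
    · right; exact ⟨ha.1, not_le.1 h0⟩
  have u2 : (PP (k+1)).real {a | ∑ i ∈ J, a i ∈ Icc 0 (√3) ∧ a (Fin.last k) ∈ Iic 0} +
      (PP (k+1)).real {a | ∑ i ∈ J, a i ∈ Ico (-√3) 0 ∧ a (Fin.last k) ∈ Ici 0} ≤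
      (PP (k+1)).real {a | |∑ i, a i| ≤ √3} := by
    rw [← measureReal_union]
    · apply ENNReal.toReal_mono (measure_ne_top _ _)
      apply measure_mono_ae
      filter_upwards [hae] with a ha h
      show |∑ i, a i| ≤ √3
      rw [hsum, abs_le]
      rcases h with ⟨h1, h2⟩ | ⟨h1, h2⟩
      · exact ⟨by linarith [h1.1, ha.1], by linarith [h1.2, show a (Fin.last k) ≤ 0 from h2]⟩
      · exact ⟨by linarith [h1.1, show 0 ≤ a (Fin.last k) from h2], by linarith [h1.2, ha.2]⟩
    · rw [Set.disjoint_left]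
      rintro a ⟨h1, _⟩ ⟨h2, _⟩
      exact absurd h1.1 (not_le.2 h2.2)
    · exact (hm measurableSet_Ico).inter (hm2 measurableSet_Ici)
  rw [k1, k2] at u2
  have p1 : 0 ≤ (PP (k+1)).real {a | ∑ i ∈ J, a i ∈ Icc 0 (√3)} := measureReal_nonneg
  have p2 : 0 ≤ (PP (k+1)).real {a | ∑ i ∈ J, a i ∈ Ico (-√3) 0} := measureReal_nonneg
  nlinarith [unif_half1, unif_half2]

lemma conc_lower_PP (k : ℕ) (hk : 2 ≤ k) :
    gaussianPDFReal 0 1 1 / 6 / √k ≤ (PP k).real {a | |∑ i, a i| ≤ √3} := by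
  have hg := gaussianPDFReal_nonneg 0 1 1
  have hk0 : (0:ℝ) < k := by exact_mod_cast (by omega : 0 < k)
  rcases Nat.even_or_odd k with he | ho
  · have := conc_lower_PP_even k Finset.univ (by simp; omega) (by simpa using he)
    rw [Finset.card_univ, Fintype.card_fin] at this
    refine le_trans ?_ this
    gcongr; norm_num
  · obtain ⟨j, rfl⟩ : ∃ j, k = j + 1 := ⟨k - 1, by omega⟩
    have hj : (Finset.univ.erase (Fin.last j)).card = j := by simp
    have h1 := conc_lower_PP_even (j+1) (Finset.univ.erase (Fin.last j)) (by rw [hj]; omega)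
      (by rw [hj]; rcases Nat.even_or_odd j with h | h
          · exact h
          · exact absurd ho (by simpa using h.add_one))
    have h2 := step_lower j
    rw [hj] at h1
    have hj0 : (0:ℝ) < j := by exact_mod_cast (by omega : 0 < j)
    have h3 : gaussianPDFReal 0 1 1 / 3 / √((j+1:ℕ):ℝ) ≤ gaussianPDFReal 0 1 1 / 3 / √j := by
      gcongr; simp
    have : gaussianPDFReal 0 1 1 / 6 / √((j+1:ℕ):ℝ) = 1/2 * (gaussianPDFReal 0 1 1 / 3 / √((j+1:ℕ):ℝ)) := by ring
    rw [this]; linarith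

lemma pow4_le (y : ℝ) : y ^ 4 ≤ 24 * (Real.exp y + Real.exp (-y)) := by
  have h := Real.pow_div_factorial_le_exp (x := |y|) (abs_nonneg y) 4
  have h2 : Real.exp |y| ≤ Real.exp y + Real.exp (-y) := by
    rcases abs_cases y with ⟨h, _⟩ | ⟨h, _⟩ <;> rw [h] <;>
      linarith [Real.exp_pos y, Real.exp_pos (-y)]
  have h3 : |y| ^ 4 = y ^ 4 := by rw [show 4 = 2 * 2 by norm_num, pow_mul, pow_mul, sq_abs]
  rw [h3] at h
  norm_num [Nat.factorial] at h
  linarith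

noncomputable def hx (x : ℝ) (y : ℝ) : ℝ := indicator (Iic x) 1 y - (x + √3) / (2 * √3)

lemma measurable_hx (x : ℝ) : Measurable (hx x) := by
  unfold hx
  exact (measurable_one.indicator measurableSet_Iic).sub_const _

lemma fourth_moment (k : ℕ) (J : Finset (Fin k)) {x : ℝ} (hxx : x ∈ Icc (-√3) (√3)) :
    ∫⁻ a, ENNReal.ofReal ((∑ i ∈ J, hx x (a i)) ^ 4) ∂(PP k)
      ≤ ENNReal.ofReal (48 * Real.exp 1 * k ^ 2) := by
  have hsg : ∀ i ∈ J, HasSubgaussianMGF (fun a : Fin k → ℝ => hx x (a i)) (1/4) (PP k) := by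
    intro i _
    have h1 : HasSubgaussianMGF (fun y => hx x y) (1/4) unif := by
      have := hasSubgaussianMGF_of_mem_Icc (μ := unif) (X := indicator (Iic x) (1 : ℝ → ℝ)) (a := 0) (b := 1)
        (measurable_one.indicator measurableSet_Iic).aemeasurable
        (ae_of_all _ fun y => by
          simp only [indicator]; split_ifs <;> simp)
      rw [integral_indicator_one measurableSet_Iic, unif_Iic hxx] at this
      have e : ((‖(1:ℝ) - 0‖₊ / 2) ^ 2 : ℝ≥0) = 1/4 := by
        simp; norm_num
      rw [e] at this
      exact this
    rw [← PP_eval k i] at h1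
    exact HasSubgaussianMGF.of_map (Y := fun a : Fin k → ℝ => a i) (X := fun y => hx x y)
      (measurable_pi_apply i).aemeasurable h1
  have hS := HasSubgaussianMGF.sum_of_iIndepFun (PP_indep k (hx x) (measurable_hx x)) hsg
  set S := fun a : Fin k → ℝ => ∑ i ∈ J, hx x (a i) with hSdef
  rcases Nat.eq_zero_or_pos k with rfl | hk
  · have : ∀ a, S a = 0 := fun a => by
      simp only [hSdef]; apply Finset.sum_eq_zero; intro i; exact i.elim0
    simp only [hSdef] at this
    simp [this]
  have hk0 : (0:ℝ) < k := by exact_mod_cast hk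
  set t := 1 / √(k:ℝ) with ht
  have ht2 : t ^ 2 = 1 / k := by rw [ht, div_pow, Real.sq_sqrt hk0.le, one_pow]
  have hpt : ∀ a, S a ^ 4 ≤ k ^ 2 * (24 * (Real.exp (t * S a) + Real.exp (-t * S a))) := by
    intro a
    have h := pow4_le (t * S a)
    have : (t * S a) ^ 4 = S a ^ 4 / k ^ 2 := by
      rw [mul_pow, show t ^ 4 = (t ^ 2) ^ 2 by ring, ht2]; field_simp
    rw [this, div_le_iff₀ (by positivity)] at h
    rw [neg_mul]; linarith
  have i1 := hS.integrable_exp_mul t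
  have i2 := hS.integrable_exp_mul (-t)
  have hI : Integrable (fun a => k ^ 2 * (24 * (Real.exp (t * S a) + Real.exp (-t * S a)))) (PP k) :=
    ((i1.add i2).const_mul 24).const_mul _
  calc ∫⁻ a, ENNReal.ofReal (S a ^ 4) ∂(PP k) ≤ ∫⁻ a, ENNReal.ofReal (k ^ 2 * (24 * (Real.exp (t * S a) + Real.exp (-t * S a)))) ∂(PP k) :=
        lintegral_mono fun a => ENNReal.ofReal_le_ofReal (hpt a)
    _ = ENNReal.ofReal (∫ a, k ^ 2 * (24 * (Real.exp (t * S a) + Real.exp (-t * S a))) ∂(PP k)) := by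
        rw [ofReal_integral_eq_lintegral_ofReal hI (ae_of_all _ fun a => by positivity)]
    _ ≤ _ := by
        apply ENNReal.ofReal_le_ofReal
        rw [integral_const_mul, integral_const_mul, integral_add i1 i2]
        have hc : ((∑ i ∈ J, (1/4 : ℝ≥0) : ℝ≥0) : ℝ) * t ^ 2 / 2 ≤ 1 := by
          rw [ht2, Finset.sum_const]
          have : (J.card : ℝ) ≤ k := by
            exact_mod_cast (Finset.card_le_univ J).trans (by simp)
          push_cast
          simp only [nsmul_eq_mul]
          rw [mul_one_div, div_div, div_le_one (by positivity)]
          linarith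
        have m1 := (hS.mgf_le t).trans (Real.exp_le_exp.2 hc)
        have hc2 : ((∑ i ∈ J, (1/4 : ℝ≥0) : ℝ≥0) : ℝ) * (-t) ^ 2 / 2 ≤ 1 := by rwa [neg_sq]
        have m2 := (hS.mgf_le (-t)).trans (Real.exp_le_exp.2 hc2)
        unfold mgf at m1 m2
        calc _ ≤ (k:ℝ) ^ 2 * (24 * (Real.exp 1 + Real.exp 1)) := by gcongr
          _ = _ := by ring

lemma decouple (k : ℕ) (J : Finset (Fin k)) (f : ℝ → ℝ) (hf : Measurable f) (K : ℝ)
    (hK : ∀ t : ℝ, (PP k).real {a | |t + ∑ i ∈ Jᶜ, a i| ≤ √3} ≤ K) :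
    ∫⁻ a in {a | |∑ i, a i| ≤ √3}, ENNReal.ofReal ((∑ i ∈ J, f (a i)) ^ 4) ∂(PP k)
      ≤ (∫⁻ a, ENNReal.ofReal ((∑ i ∈ J, f (a i)) ^ 4) ∂(PP k)) * ENNReal.ofReal K := by
  have hI := PP_indep_sum k J Jᶜ disjoint_compl_right
  set U : (Fin k → ℝ) → ℝ × ℝ := fun a => (∑ i ∈ J, f (a i), ∑ i ∈ J, a i) with hU
  set V : (Fin k → ℝ) → ℝ := fun a => ∑ i ∈ Jᶜ, a i with hV
  have hUm : Measurable U := by fun_prop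
  have hVm : Measurable V := by fun_prop
  have hUV : IndepFun U V (PP k) := by
    have := hI.comp (φ := fun v : J → ℝ => (∑ i, f (v i), ∑ i, v i))
      (ψ := fun w : (Jᶜ : Finset (Fin k)) → ℝ => ∑ i, w i) (by fun_prop) (by fun_prop)
    convert this using 1
    · ext a
      · exact (Finset.sum_coe_sort J (fun i => f (a i))).symm
      · exact (Finset.sum_coe_sort J (fun i => a i)).symm
    · ext a; exact (Finset.sum_coe_sort Jᶜ (fun i => a i)).symm
  have hmap := (indepFun_iff_map_prod_eq_prod_map_map hUm.aemeasurable hVm.aemeasurable).1 hUV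
  set E : Set ((ℝ × ℝ) × ℝ) := {p | |p.1.2 + p.2| ≤ √3} with hE
  have hEm : MeasurableSet E := measurableSet_le (by fun_prop) (by fun_prop)
  set G : (ℝ × ℝ) × ℝ → ℝ≥0∞ := fun p => ENNReal.ofReal (p.1.1 ^ 4) * E.indicator 1 p with hG
  have hGm : Measurable G := by
    apply Measurable.mul (by fun_prop)
    exact measurable_one.indicator hEm
  have hms : MeasurableSet {a : Fin k → ℝ | |∑ i, a i| ≤ √3} :=
    measurableSet_le (by fun_prop) (by fun_prop)
  have e1 : ∫⁻ a in {a | |∑ i, a i| ≤ √3}, ENNReal.ofReal ((∑ i ∈ J, f (a i)) ^ 4) ∂(PP k)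
      = ∫⁻ a, G (U a, V a) ∂(PP k) := by
    rw [← lintegral_indicator hms]
    congr 1; ext a
    have hs : ∑ i, a i = ∑ i ∈ J, a i + ∑ i ∈ Jᶜ, a i := (Finset.sum_add_sum_compl J _).symm
    by_cases h : |∑ i, a i| ≤ √3
    · have h' : (U a, V a) ∈ E := by
        show |∑ i ∈ J, a i + ∑ i ∈ Jᶜ, a i| ≤ √3
        rwa [← hs]
      rw [indicator_of_mem (show a ∈ {a : Fin k → ℝ | |∑ i, a i| ≤ √3} from h)]
      simp only [hG]
      rw [indicator_of_mem h', Pi.one_apply, mul_one]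
    · have h' : (U a, V a) ∉ E := by
        intro h2
        have h2 : |∑ i ∈ J, a i + ∑ i ∈ Jᶜ, a i| ≤ √3 := h2
        rw [← hs] at h2; exact h h2
      rw [indicator_of_notMem (show a ∉ {a : Fin k → ℝ | |∑ i, a i| ≤ √3} from h)]
      simp only [hG]
      rw [indicator_of_notMem h', mul_zero]
  rw [e1, ← lintegral_map (f := G) (g := fun a => (U a, V a)) hGm (hUm.prodMk hVm), hmap,
    lintegral_prod _ hGm.aemeasurable]
  have e2 : ∀ u : ℝ × ℝ, ∫⁻ v, G (u, v) ∂((PP k).map V) ≤ ENNReal.ofReal (u.1 ^ 4) * ENNReal.ofReal K := by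
    intro u
    have hsm : MeasurableSet {v : ℝ | |u.2 + v| ≤ √3} := measurableSet_le (by fun_prop) (by fun_prop)
    have : ∀ v, G (u, v) = ENNReal.ofReal (u.1 ^ 4) * ({v : ℝ | |u.2 + v| ≤ √3}.indicator 1 v) := fun v => rfl
    simp_rw [this]
    rw [lintegral_const_mul _ (measurable_one.indicator hsm), lintegral_indicator_one hsm,
      Measure.map_apply hVm hsm]
    gcongr
    have := hK u.2
    rw [measureReal_def] at this
    exact ENNReal.le_ofReal_iff_toReal_le (measure_ne_top _ _) (measureReal_nonneg.trans (hK 0)) |>.2 this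
  calc _ ≤ ∫⁻ u, ENNReal.ofReal (u.1 ^ 4) * ENNReal.ofReal K ∂((PP k).map U) := lintegral_mono e2
    _ = _ := by
      rw [lintegral_mul_const _ (by fun_prop), lintegral_map (by fun_prop) hUm]

lemma PP_eq_cond (k : ℕ) :
    PP k = ProbabilityTheory.cond volume (Set.pi univ (fun _ : Fin k => Icc (-√3) (√3))) := by
  unfold PP
  apply Measure.pi_eq
  intro s hs
  have hm : MeasurableSet (Set.pi univ (fun _ : Fin k => Icc (-√3) (√3))) :=
    MeasurableSet.univ_pi fun _ => measurableSet_Icc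
  unfold unif
  simp only [cond_apply hm, cond_apply measurableSet_Icc]
  rw [← Set.pi_inter_distrib, volume_pi_pi, volume_pi_pi, Finset.prod_mul_distrib]
  congr 1
  rw [vol_Icc3, Finset.prod_const, Finset.prod_const, ENNReal.inv_pow]

lemma cond_eq_PP (k : ℕ) :
    ProbabilityTheory.cond volume
      {a : Fin k → ℝ | (∀ i, a i ∈ Set.Icc (-√3) (√3)) ∧ (0 - ∑ i, a i) ∈ Set.Icc (-√3) (√3)}
    = ProbabilityTheory.cond (PP k) {a | |∑ i, a i| ≤ √3} := by
  have hm : MeasurableSet (Set.pi univ (fun _ : Fin k => Icc (-√3) (√3))) :=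
    MeasurableSet.univ_pi fun _ => measurableSet_Icc
  have hms : MeasurableSet {a : Fin k → ℝ | |∑ i, a i| ≤ √3} :=
    measurableSet_le (by fun_prop) (by fun_prop)
  rw [PP_eq_cond, cond_cond_eq_cond_inter' hm hms]
  · congr 1
    ext a
    simp only [mem_inter_iff, mem_pi, mem_univ, true_imp_iff]
    refine and_congr Iff.rfl ?_
    show _ ↔ |∑ i, a i| ≤ √3
    rw [abs_le, mem_Icc]
    constructor <;> rintro ⟨h1, h2⟩ <;> constructor <;> linarith
  · rw [volume_pi_pi, vol_Icc3, Finset.prod_const]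
    exact ENNReal.pow_ne_top ENNReal.ofReal_ne_top

lemma gDie_eq (n : ℕ) (A : Fin n → ℝ) (x : ℝ) : gDie n A x = ∑ i, hx x (A i) := by
  unfold gDie hx
  rw [Finset.sum_sub_distrib, Finset.card_filter]
  push_cast
  congr 1
  simp

lemma abs_hx_le {x : ℝ} (h : x ∈ Icc (-√3) (√3)) (y : ℝ) : |hx x y| ≤ 1 := by
  have h3 := sqrt3_pos
  have p0 : 0 ≤ (x + √3) / (2 * √3) := div_nonneg (by linarith [h.1]) (by positivity)
  have p1 : (x + √3) / (2 * √3) ≤ 1 := by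
    rw [div_le_one (by positivity)]; linarith [h.2]
  unfold hx
  simp only [indicator]
  rw [abs_le]
  split_ifs <;> (try simp only [Pi.one_apply]) <;> constructor <;> linarith

lemma measurable_hx2 : Measurable (fun p : ℝ × ℝ => hx p.1 p.2) := by
  have : (fun p : ℝ × ℝ => hx p.1 p.2) =
      fun p => indicator {p : ℝ × ℝ | p.2 ≤ p.1} 1 p - (p.1 + √3) / (2 * √3) := by
    ext p; rfl
  rw [this]
  apply Measurable.sub
  · exact measurable_one.indicator (measurableSet_le measurable_snd measurable_fst)
  · fun_prop

lemma measurable_gDie2 (n : ℕ) : Measurable (fun p : (Fin n → ℝ) × ℝ => gDie n p.1 p.2) := by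
  simp only [gDie_eq]
  apply Finset.measurable_sum
  intro i _
  exact measurable_hx2.comp (measurable_snd.prodMk ((measurable_pi_apply i).comp measurable_fst))

lemma meanS_eq (f : ℝ → ℝ) : meanS f = ∫ x, f x ∂unif := by
  rw [integral_unif]; rfl

lemma ae_unif : ∀ᵐ x ∂unif, x ∈ Icc (-√3) (√3) := by
  unfold unif; exact ae_cond_mem measurableSet_Icc

lemma varDie_le (n : ℕ) (A : Fin n → ℝ) :
    ENNReal.ofReal ‖varDie n A ^ 2‖ ≤ ∫⁻ x, ENNReal.ofReal (gDie n A x ^ 4) ∂unif := by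
  have hgm : Measurable (gDie n A) := by
    have he : gDie n A = fun x => ∑ i, hx x (A i) := funext fun x => gDie_eq n A x
    rw [he]
    refine Finset.measurable_sum _ fun i _ => ?_
    have hc : Measurable (fun x : ℝ => (x, A i)) := measurable_prodMk_right
    exact measurable_hx2.comp hc
  have hb : ∀ᵐ x ∂unif, ‖gDie n A x‖ ≤ n := by
    filter_upwards [ae_unif] with x hx
    rw [gDie_eq]
    refine (norm_sum_le _ _).trans ?_
    calc _ ≤ ∑ i : Fin n, (1:ℝ) := Finset.sum_le_sum fun i _ => abs_hx_le hx _
      _ = n := by simp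
  have hg : MemLp (gDie n A) 2 unif := MemLp.of_bound hgm.aestronglyMeasurable n hb
  have hg2 : MemLp (fun x => gDie n A x ^ 2) 2 unif := by
    apply MemLp.of_bound (hgm.pow_const 2).aestronglyMeasurable ((n:ℝ) ^ 2)
    filter_upwards [hb] with x hx
    rw [norm_pow]; gcongr
  have v1 := variance_eq_sub hg
  have v2 := variance_eq_sub hg2
  have hv : varDie n A = variance (gDie n A) unif := by
    rw [v1]; unfold varDie; rw [meanS_eq, meanS_eq]; rfl
  have n1 := variance_nonneg (gDie n A) unif
  have n2 := variance_nonneg (fun x => gDie n A x ^ 2) unif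
  have e4 : (∫ x, ((fun x => gDie n A x ^ 2) ^ 2) x ∂unif) = ∫ x, gDie n A x ^ 4 ∂unif := by
    congr 1; ext x; simp only [Pi.pow_apply]; ring
  rw [v2, e4] at n2
  have hle : varDie n A ^ 2 ≤ ∫ x, gDie n A x ^ 4 ∂unif := by
    have : variance (gDie n A) unif ≤ ∫ x, gDie n A x ^ 2 ∂unif := by
      rw [v1]
      simp only [Pi.pow_apply]
      nlinarith [sq_nonneg (∫ x, gDie n A x ∂unif)]
    calc _ ≤ (∫ x, gDie n A x ^ 2 ∂unif) ^ 2 := by rw [hv]; gcongr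
      _ ≤ _ := by linarith
  have hi : Integrable (fun x => gDie n A x ^ 4) unif := by
    apply Integrable.of_bound (hgm.pow_const 4).aestronglyMeasurable ((n:ℝ) ^ 4)
    filter_upwards [hb] with x hx
    rw [norm_pow]; gcongr
  rw [← ofReal_integral_eq_lintegral_ofReal hi (ae_of_all _ fun x => by positivity)]
  apply ENNReal.ofReal_le_ofReal
  rw [Real.norm_of_nonneg (by positivity)]
  exact hle

lemma pow4_three (a b c : ℝ) : (a + b + c) ^ 4 ≤ 27 * (a ^ 4 + b ^ 4 + c ^ 4) := by
  have h1 : (a + b + c) ^ 2 ≤ 3 * (a ^ 2 + b ^ 2 + c ^ 2) := by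
    nlinarith [sq_nonneg (a - b), sq_nonneg (b - c), sq_nonneg (a - c)]
  have h2 : (a ^ 2 + b ^ 2 + c ^ 2) ^ 2 ≤ 3 * (a ^ 4 + b ^ 4 + c ^ 4) := by
    nlinarith [sq_nonneg (a ^ 2 - b ^ 2), sq_nonneg (b ^ 2 - c ^ 2), sq_nonneg (a ^ 2 - c ^ 2)]
  calc (a + b + c) ^ 4 = ((a + b + c) ^ 2) ^ 2 := by ring
    _ ≤ (3 * (a ^ 2 + b ^ 2 + c ^ 2)) ^ 2 := by gcongr
    _ ≤ _ := by nlinarith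

noncomputable def RR : ℝ :=
  Real.exp (3/2) * (Real.pi / √(3/32)) * (6 / gaussianPDFReal 0 1 1)

lemma RR_pos : 0 < RR := by
  have : 0 < gaussianPDFReal 0 1 1 := gaussianPDFReal_pos 0 1 1 one_ne_zero
  have := Real.pi_pos
  unfold RR; positivity

lemma PE_pos (k : ℕ) (hk : 4 ≤ k) : 0 < (PP k).real {a | |∑ i, a i| ≤ √3} := by
  have g : 0 < gaussianPDFReal 0 1 1 := gaussianPDFReal_pos 0 1 1 one_ne_zero
  have hk0 : (0:ℝ) < k := by exact_mod_cast (by omega : 0 < k)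
  exact lt_of_lt_of_le (by positivity) (conc_lower_PP k (by omega))

lemma half_bound (k : ℕ) (hk : 4 ≤ k) (J : Finset (Fin k)) (hJ : k / 2 ≤ (Jᶜ).card)
    {x : ℝ} (hxx : x ∈ Icc (-√3) (√3)) :
    ∫⁻ a, ENNReal.ofReal ((∑ i ∈ J, hx x (a i)) ^ 4)
        ∂(ProbabilityTheory.cond (PP k) {a | |∑ i, a i| ≤ √3})
      ≤ ENNReal.ofReal (48 * Real.exp 1 * RR * k ^ 2) := by
  have g : 0 < gaussianPDFReal 0 1 1 := gaussianPDFReal_pos 0 1 1 one_ne_zero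
  have hpi := Real.pi_pos
  have hk0 : (0:ℝ) < k := by exact_mod_cast (by omega : 0 < k)
  set K := Real.exp (3/2) * (Real.pi / √(k * (3/32))) with hKdef
  have hK0 : 0 ≤ K := by positivity
  have hK : ∀ t : ℝ, (PP k).real {a | |t + ∑ i ∈ Jᶜ, a i| ≤ √3} ≤ K := by
    intro t
    refine (conc_upper_PP k Jᶜ (by omega) t).trans ?_
    have : (k:ℝ) * (3/32) ≤ ((Jᶜ).card / 2 : ℕ) * (3/4) := by
      have h8 : k ≤ 8 * ((Jᶜ).card / 2) := by omega
      have h8' : (k:ℝ) ≤ 8 * ((Jᶜ).card / 2 : ℕ) := by exact_mod_cast h8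
      linarith
    rw [hKdef]
    gcongr
  have hd := decouple k J (hx x) (measurable_hx x) K hK
  have hf := fourth_moment k J hxx
  have hP := PE_pos k hk
  have hL := conc_lower_PP k (by omega)
  set p := (PP k).real {a | |∑ i, a i| ≤ √3} with hp
  have hpE : (PP k) {a | |∑ i, a i| ≤ √3} = ENNReal.ofReal p := (ofReal_measureReal).symm
  rw [ProbabilityTheory.cond, lintegral_smul_measure, hpE, smul_eq_mul, ← ENNReal.ofReal_inv_of_pos hP]
  have hKR : p⁻¹ * K ≤ RR := by
    have h1 : p⁻¹ ≤ (gaussianPDFReal 0 1 1 / 6 / √k)⁻¹ := inv_anti₀ (by positivity) hL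
    calc p⁻¹ * K ≤ (gaussianPDFReal 0 1 1 / 6 / √k)⁻¹ * K := by gcongr
      _ = RR := by
        rw [hKdef, RR, Real.sqrt_mul hk0.le]
        have : √(3/32:ℝ) ≠ 0 := by positivity
        field_simp
  calc _ ≤ ENNReal.ofReal p⁻¹ * (ENNReal.ofReal (48 * Real.exp 1 * k ^ 2) * ENNReal.ofReal K) := by
        gcongr
        exact hd.trans (by gcongr)
    _ = ENNReal.ofReal (p⁻¹ * ((48 * Real.exp 1 * k ^ 2) * K)) := by
        rw [← ENNReal.ofReal_mul (by positivity), ← ENNReal.ofReal_mul (by positivity)]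
    _ ≤ _ := by
        apply ENNReal.ofReal_le_ofReal
        calc _ = (48 * Real.exp 1 * k ^ 2) * (p⁻¹ * K) := by ring
          _ ≤ (48 * Real.exp 1 * k ^ 2) * RR := by gcongr
          _ = _ := by ring

lemma measurable_extendDie (k : ℕ) : Measurable (extendDie (k+1) 0) := by
  rw [measurable_pi_iff]
  intro i
  unfold extendDie
  split_ifs with h
  · exact measurable_pi_apply _
  · fun_prop

lemma gDie_extend (k : ℕ) (a : Fin k → ℝ) (x : ℝ) :
    gDie (k+1) (extendDie (k+1) 0 a) x = ∑ i, hx x (a i) + hx x (0 - ∑ i, a i) := by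
  rw [gDie_eq, Fin.sum_univ_castSucc]
  congr 1
  · apply Finset.sum_congr rfl
    intro i _
    have : extendDie (k+1) 0 a i.castSucc = a i := by
      unfold extendDie
      rw [dif_pos (show ((i.castSucc : Fin (k+1)) : ℕ) < k + 1 - 1 by simp)]
      rfl
    rw [this]
  · have : extendDie (k+1) 0 a (Fin.last k) = 0 - ∑ i, a i := by
      unfold extendDie
      rw [dif_neg (by simp)]
      rfl
    rw [this]

lemma g_bound (k : ℕ) (hk : 4 ≤ k) {x : ℝ} (hxx : x ∈ Icc (-√3) (√3)) :
    ∫⁻ a, ENNReal.ofReal (gDie (k+1) (extendDie (k+1) 0 a) x ^ 4)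
        ∂(ProbabilityTheory.cond (PP k) {a | |∑ i, a i| ≤ √3})
      ≤ ENNReal.ofReal (27 * (96 * Real.exp 1 * RR + 1) * ((k + 1 : ℕ):ℝ) ^ 2) := by
  have hP := PE_pos k hk
  have hR := RR_pos
  set ν := ProbabilityTheory.cond (PP k) {a | |∑ i, a i| ≤ √3} with hν
  have : IsProbabilityMeasure ν := by
    apply cond_isProbabilityMeasure
    intro h0
    rw [measureReal_def, h0] at hP
    simp at hP
  set J : Finset (Fin k) := Finset.univ.filter (fun i => (i:ℕ) < k / 2) with hJ
  have hJc : J.card = k / 2 := by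
    rw [hJ, Fin.card_filter_val_lt]; omega
  have hJc2 : (Jᶜ).card = k - k / 2 := by rw [Finset.card_compl, hJc, Fintype.card_fin]
  have b1 := half_bound k hk J (by omega) hxx
  have b2 := half_bound k hk Jᶜ (by rw [compl_compl]; omega) hxx
  have hpt : ∀ a : Fin k → ℝ, ENNReal.ofReal (gDie (k+1) (extendDie (k+1) 0 a) x ^ 4) ≤
      27 * (ENNReal.ofReal ((∑ i ∈ J, hx x (a i)) ^ 4) + ENNReal.ofReal ((∑ i ∈ Jᶜ, hx x (a i)) ^ 4) + 1) := by
    intro a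
    rw [gDie_extend, ← Finset.sum_add_sum_compl J]
    have h1 := pow4_three (∑ i ∈ J, hx x (a i)) (∑ i ∈ Jᶜ, hx x (a i)) (hx x (0 - ∑ i, a i))
    have h2 : hx x (0 - ∑ i, a i) ^ 4 ≤ 1 := by
      have := abs_hx_le hxx (0 - ∑ i, a i)
      rw [show hx x (0 - ∑ i, a i) ^ 4 = |hx x (0 - ∑ i, a i)| ^ 4 by
        rw [show 4 = 2 * 2 by norm_num, pow_mul, pow_mul, sq_abs]]
      exact pow_le_one₀ (abs_nonneg _) this
    rw [← ENNReal.ofReal_one, ← ENNReal.ofReal_add (by positivity) (by positivity),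
      ← ENNReal.ofReal_add (by positivity) (by positivity),
      show (27 : ℝ≥0∞) = ENNReal.ofReal 27 by simp, ← ENNReal.ofReal_mul (by norm_num)]
    apply ENNReal.ofReal_le_ofReal
    linarith
  have hm : ∀ J : Finset (Fin k), Measurable (fun a : Fin k → ℝ => ENNReal.ofReal ((∑ i ∈ J, hx x (a i)) ^ 4)) := by
    intro J
    have := measurable_hx x
    fun_prop
  calc _ ≤ ∫⁻ a, 27 * (ENNReal.ofReal ((∑ i ∈ J, hx x (a i)) ^ 4) + ENNReal.ofReal ((∑ i ∈ Jᶜ, hx x (a i)) ^ 4) + 1) ∂ν :=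
        lintegral_mono hpt
    _ = 27 * (∫⁻ a, ENNReal.ofReal ((∑ i ∈ J, hx x (a i)) ^ 4) ∂ν + ∫⁻ a, ENNReal.ofReal ((∑ i ∈ Jᶜ, hx x (a i)) ^ 4) ∂ν + 1) := by
        have hm12 : Measurable (fun a : Fin k → ℝ => ENNReal.ofReal ((∑ i ∈ J, hx x (a i)) ^ 4) +
            ENNReal.ofReal ((∑ i ∈ Jᶜ, hx x (a i)) ^ 4)) := (hm J).add (hm Jᶜ)
        have hm123 : Measurable (fun a : Fin k → ℝ => ENNReal.ofReal ((∑ i ∈ J, hx x (a i)) ^ 4) +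
            ENNReal.ofReal ((∑ i ∈ Jᶜ, hx x (a i)) ^ 4) + 1) := hm12.add_const 1
        rw [lintegral_const_mul _ hm123, lintegral_add_left hm12, lintegral_add_left (hm J)]
        simp
    _ ≤ 27 * (ENNReal.ofReal (48 * Real.exp 1 * RR * k ^ 2) + ENNReal.ofReal (48 * Real.exp 1 * RR * k ^ 2) + 1) := by
        gcongr
    _ ≤ _ := by
        rw [← ENNReal.ofReal_one, ← ENNReal.ofReal_add (by positivity) (by positivity),
          ← ENNReal.ofReal_add (by positivity) (by positivity),
          show (27 : ℝ≥0∞) = ENNReal.ofReal 27 by simp, ← ENNReal.ofReal_mul (by norm_num)]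
        apply ENNReal.ofReal_le_ofReal
        push_cast
        have hk0 : (0:ℝ) ≤ k := by positivity
        have e1 : (k:ℝ) ^ 2 ≤ (k + 1) ^ 2 := by gcongr; linarith
        have e2 : (1:ℝ) ≤ ((k:ℝ) + 1) ^ 2 := by nlinarith
        have e3 : 0 ≤ Real.exp 1 * RR := by positivity
        nlinarith [mul_le_mul_of_nonneg_left e1 e3]

theorem var_second_moment :
    ∃ C > (0 : ℝ), ∃ N : ℕ, ∀ n : ℕ, N ≤ n →
      (∫ A, varDie n A ^ 2 ∂(diceMeasure n (-Real.sqrt 3) (Real.sqrt 3) 0))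
        ≤ C * (n : ℝ) ^ 2 := by
  have hR := RR_pos
  refine ⟨27 * (96 * Real.exp 1 * RR + 1), by positivity, 5, ?_⟩
  intro n hn
  obtain ⟨k, rfl⟩ : ∃ k, n = k + 1 := ⟨n - 1, by omega⟩
  have hk : 4 ≤ k := by omega
  have hcond : diceMeasure (k+1) (-Real.sqrt 3) (Real.sqrt 3) 0 =
      Measure.map (extendDie (k+1) 0) (ProbabilityTheory.cond (PP k) {a | |∑ i, a i| ≤ √3}) := by
    unfold diceMeasure
    congr 1
    exact cond_eq_PP k
  rw [hcond]
  set ν := ProbabilityTheory.cond (PP k) {a | |∑ i, a i| ≤ √3} with hν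
  refine (le_abs_self _).trans ?_
  rw [← Real.norm_eq_abs]
  refine (norm_integral_le_lintegral_norm _).trans ?_
  apply ENNReal.toReal_le_of_le_ofReal (by positivity)
  refine (lintegral_map_le _ _).trans ?_
  have hgm : Measurable (fun p : (Fin k → ℝ) × ℝ => ENNReal.ofReal (gDie (k+1) (extendDie (k+1) 0 p.1) p.2 ^ 4)) := by
    have := (measurable_gDie2 (k+1)).comp
      (((measurable_extendDie k).comp measurable_fst).prodMk (measurable_snd (α := Fin k → ℝ) (β := ℝ)))
    exact (this.pow_const 4).ennreal_ofReal
  calc _ ≤ ∫⁻ a, ∫⁻ x, ENNReal.ofReal (gDie (k+1) (extendDie (k+1) 0 a) x ^ 4) ∂unif ∂ν :=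
        lintegral_mono fun a => varDie_le _ _
    _ = ∫⁻ x, ∫⁻ a, ENNReal.ofReal (gDie (k+1) (extendDie (k+1) 0 a) x ^ 4) ∂ν ∂unif :=
        lintegral_lintegral_swap hgm.aemeasurable
    _ ≤ ∫⁻ x, ENNReal.ofReal (27 * (96 * Real.exp 1 * RR + 1) * ((k + 1 : ℕ):ℝ) ^ 2) ∂unif := by
        apply lintegral_mono_ae
        filter_upwards [ae_unif] with x hx
        exact g_bound k hk hx
    _ = _ := by simp
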